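/- Let ρ be a density matrix on ℂ²⊗ℂ² (a two-qubit state). Then the minimal eigenvalue of the partial transpose ρ^{T_A} equals −1/2 if and only if ρ is maximally entangled, i.e. ρ = ψψᴴ for some maximally entangled unit vector ψ : Fin 2 × Fin 2 → ℂ. -/

import Mathlib

open Matrix Polynomial
open scoped ComplexOrder

noncomputable section

/-- Partial transpose on subsystem A of a bipartite matrix. -/
def ptA {m n : ℕ} (ρ : Matrix (Fin m × Fin n) (Fin m × Fin n) ℂ) :
    Matrix (Fin m × Fin n) (Fin m × Fin n) ℂ :=
  fun p q => ρ (q.1, p.2) (p.1, q.2)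

/-- A density matrix: positive semidefinite with trace one. -/
def IsDensityMatrix {k : Type*} [Fintype k] [DecidableEq k] (ρ : Matrix k k ℂ) : Prop :=
  ρ.PosSemidef ∧ ρ.trace = 1

open Classical in
/-- Minimal (real) eigenvalue of a Hermitian matrix (junk value 0 otherwise). -/
noncomputable def minEig {k : Type*} [Fintype k] [DecidableEq k] (A : Matrix k k ℂ) : ℝ :=
  if h : A.IsHermitian then ⨅ i, h.eigenvalues i else 0

/-- The rank-one projection |ψ⟩⟨ψ| of a vector ψ. -/
def proj {k : Type*} [Fintype k] (ψ : k → ℂ) : Matrix k k ℂ :=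
  Matrix.vecMulVec ψ (star ψ)

/-- A unit vector. -/
def IsUnitVec {k : Type*} [Fintype k] (ψ : k → ℂ) : Prop :=
  ∑ p, ‖ψ p‖ ^ 2 = 1

/-- Reduced matrix on subsystem A of a pure state ψ. -/
def reducedA {n : ℕ} (ψ : Fin n × Fin n → ℂ) : Matrix (Fin n) (Fin n) ℂ :=
  fun i k => ∑ j, ψ (i, j) * (starRingEnd ℂ) (ψ (k, j))

/-- ψ is maximally entangled iff its reduced matrix is (1/n)·identity. -/
def MaxEntangled {n : ℕ} (ψ : Fin n × Fin n → ℂ) : Prop :=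
  reducedA ψ = ((n : ℂ))⁻¹ • (1 : Matrix (Fin n) (Fin n) ℂ)

lemma aux_trace {k : Type*} [Fintype k] [DecidableEq k] (ρ : Matrix k k ℂ)
    (hρ : ρ.PosSemidef) (ht : ρ.trace = 1) (w : k → ℂ) (hw : star w ⬝ᵥ w = 1) :
    star w ⬝ᵥ ρ *ᵥ w ≤ 1 ∧ (star w ⬝ᵥ ρ *ᵥ w = 1 → ρ = proj w) := by
  set W : Matrix k k ℂ := proj w with hW
  have hWH : Wᴴ = W := by
    rw [hW, proj, conjTranspose_vecMulVec, star_star]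
  have hWW : W * W = W := by
    rw [hW, proj, vecMulVec_mul_vecMulVec, hw, one_smul]
  have hWrW : W * ρ * W = (star w ⬝ᵥ ρ *ᵥ w) • W := by
    rw [hW, proj, vecMulVec_mul, vecMulVec_mul_vecMulVec, dotProduct_mulVec]
    ext i j
    simp [vecMulVec_apply]
    ring
  have htW : W.trace = 1 := by
    rw [hW, proj, trace_vecMulVec, dotProduct_comm, hw]
  have hP : (1 - W)ᴴ = 1 - W := by rw [conjTranspose_sub, conjTranspose_one, hWH]
  have hS : ((1 - W) * ρ * (1 - W)).PosSemidef := by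
    have := hρ.conjTranspose_mul_mul_same (1 - W)
    rwa [hP] at this
  have htr : ((1 - W) * ρ * (1 - W)).trace = 1 - star w ⬝ᵥ ρ *ᵥ w := by
    have e1 : ((1 - W) * ρ * (1 - W)).trace = (ρ * (1 - W)).trace := by
      rw [trace_mul_comm, ← mul_assoc]
      have : (1 - W) * (1 - W) = 1 - W := by
        rw [sub_mul, one_mul, mul_sub, hWW]; simp
      rw [this, trace_mul_comm]
    have e2 : (ρ * W).trace = (W * ρ * W).trace := by
      rw [trace_mul_comm (W * ρ) W, ← mul_assoc, hWW, trace_mul_comm]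
    rw [e1, mul_sub, trace_sub, e2, hWrW, mul_one, ht, trace_smul, htW]
    simp
  refine ⟨?_, fun h => ?_⟩
  · have := hS.trace_nonneg
    rw [htr] at this
    exact sub_nonneg.mp this
  · have h0 : (1 - W) * ρ * (1 - W) = 0 := by
      rw [← hS.trace_eq_zero_iff, htr, h, sub_self]
    obtain ⟨B, hB⟩ : ∃ B : Matrix k k ℂ, ρ = Bᴴ * B := by
      open scoped MatrixOrder in
      exact CStarAlgebra.nonneg_iff_eq_star_mul_self.mp hρ.nonneg
    have h1 : B * (1 - W) = 0 := by
      rw [← conjTranspose_mul_self_eq_zero, conjTranspose_mul, hP, ← h0, hB]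
      simp only [mul_assoc]
    have h2 : ρ * (1 - W) = 0 := by rw [hB, mul_assoc, h1, mul_zero]
    have h3 : ρ = ρ * W := by
      rw [mul_sub, mul_one] at h2
      exact sub_eq_zero.mp h2
    have h4 : ρ = W * ρ := by
      have := congrArg conjTranspose h3
      rwa [conjTranspose_mul, hWH, hρ.1.eq] at this
    rw [h4, h3, ← mul_assoc, hWrW, h, one_smul]

/-- Decomposition of the quadratic form of the partial transpose. -/
lemma aux_identity (ρ : Matrix (Fin 2 × Fin 2) (Fin 2 × Fin 2) ℂ) (v : Fin 2 × Fin 2 → ℂ)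
    (x y z w : Fin 2 × Fin 2 → ℂ)
    (hx : x = fun p => if p.1 = 0 then v (0, p.2) else 0)
    (hy : y = fun p => if p.1 = 0 then 0 else v (1, p.2))
    (hz : z = fun p => if p.1 = 0 then v (1, p.2) else v (0, p.2))
    (hw : w = fun p => if p.1 = 0 then v (1, p.2) else - v (0, p.2)) :
    star v ⬝ᵥ ptA ρ *ᵥ v = star x ⬝ᵥ ρ *ᵥ x + star y ⬝ᵥ ρ *ᵥ y
      + (1/2) * (star z ⬝ᵥ ρ *ᵥ z) - (1/2) * (star w ⬝ᵥ ρ *ᵥ w) := by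
  subst hx hy hz hw
  simp [dotProduct, mulVec, ptA, Fintype.sum_prod_type, Fin.sum_univ_two]
  ring

lemma aux_quad (ρ : Matrix (Fin 2 × Fin 2) (Fin 2 × Fin 2) ℂ) (hρ : IsDensityMatrix ρ)
    (v : Fin 2 × Fin 2 → ℂ) (hv : star v ⬝ᵥ v = 1) :
    -(1/2) ≤ star v ⬝ᵥ ptA ρ *ᵥ v ∧ (star v ⬝ᵥ ptA ρ *ᵥ v = -(1/2) →
      ∃ ψ : Fin 2 × Fin 2 → ℂ, IsUnitVec ψ ∧ MaxEntangled ψ ∧ ρ = proj ψ) := by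
  obtain ⟨hp, ht⟩ := hρ
  set x : Fin 2 × Fin 2 → ℂ := fun p => if p.1 = 0 then v (0, p.2) else 0 with hx
  set y : Fin 2 × Fin 2 → ℂ := fun p => if p.1 = 0 then 0 else v (1, p.2) with hy
  set z : Fin 2 × Fin 2 → ℂ := fun p => if p.1 = 0 then v (1, p.2) else v (0, p.2) with hz
  set w : Fin 2 × Fin 2 → ℂ := fun p => if p.1 = 0 then v (1, p.2) else - v (0, p.2) with hw
  have hid := aux_identity ρ v x y z w hx hy hz hw
  have hw1 : star w ⬝ᵥ w = 1 := by
    rw [← hv]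
    simp [hw, dotProduct, Fintype.sum_prod_type, Fin.sum_univ_two]
    ring
  obtain ⟨hle, heq⟩ := aux_trace ρ hp ht w hw1
  have px := hp.dotProduct_mulVec_nonneg x
  have py := hp.dotProduct_mulVec_nonneg y
  have pz := hp.dotProduct_mulVec_nonneg z
  rw [hid]
  rw [Complex.le_def] at px py pz hle
  simp only [Complex.zero_re, Complex.zero_im, Complex.one_re, Complex.one_im] at px py pz hle
  obtain ⟨px, ix⟩ := px
  obtain ⟨py, iy⟩ := py
  obtain ⟨pz, iz⟩ := pz
  obtain ⟨pw, iw⟩ := hle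
  have half : (1/2 : ℂ) = ((1/2 : ℝ) : ℂ) := by push_cast; rfl
  constructor
  · rw [Complex.le_def, half]
    simp only [Complex.add_re, Complex.sub_re, Complex.add_im, Complex.sub_im, Complex.neg_re,
      Complex.neg_im, Complex.re_ofReal_mul, Complex.im_ofReal_mul, Complex.ofReal_re,
      Complex.ofReal_im]
    constructor <;> linarith
  · intro h
    have hre := congrArg Complex.re h
    rw [half] at hre
    simp only [Complex.add_re, Complex.sub_re, Complex.neg_re,
      Complex.re_ofReal_mul, Complex.ofReal_re] at hre
    have ex : star x ⬝ᵥ ρ *ᵥ x = 0 := Complex.ext (by simp; linarith) (by simp; linarith)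
    have ey : star y ⬝ᵥ ρ *ᵥ y = 0 := Complex.ext (by simp; linarith) (by simp; linarith)
    have ez : star z ⬝ᵥ ρ *ᵥ z = 0 := Complex.ext (by simp; linarith) (by simp; linarith)
    have ew : star w ⬝ᵥ ρ *ᵥ w = 1 := Complex.ext (by simp; linarith) (by simp; linarith)
    have hρw := heq ew
    have key : ∀ u : Fin 2 × Fin 2 → ℂ, star u ⬝ᵥ ρ *ᵥ u = 0 → star w ⬝ᵥ u = 0 := by
      intro u hu
      rw [hρw, proj, vecMulVec_mulVec] at hu
      have : star u ⬝ᵥ w = star (star w ⬝ᵥ u) := by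
        rw [star_dotProduct]
      simp only [op_smul_eq_smul, dotProduct_smul, smul_eq_mul, this] at hu
      simpa using hu
    have kx := key x ex
    have kz := key z ez
    have ky := key y ey
    refine ⟨w, ?_, ?_, hρw⟩
    · have := hw1
      simp only [dotProduct, Pi.star_apply, RCLike.star_def, Complex.conj_mul'] at this
      unfold IsUnitVec
      exact_mod_cast this
    · simp [hw, hx, hy, hz, dotProduct, Fintype.sum_prod_type, Fin.sum_univ_two] at kx ky kz hv
      have h00 : v (1,0) * (starRingEnd ℂ) (v (1,0)) + v (1,1) * (starRingEnd ℂ) (v (1,1)) = 1/2 := by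
        linear_combination (1/2) * kz + (1/2) * hv
      have h11 : v (0,0) * (starRingEnd ℂ) (v (0,0)) + v (0,1) * (starRingEnd ℂ) (v (0,1)) = 1/2 := by
        linear_combination -(1/2) * kz + (1/2) * hv
      unfold MaxEntangled reducedA
      ext i j
      fin_cases i <;> fin_cases j <;> simp [hw, Fin.sum_univ_two]
      · linear_combination h00
      · linear_combination ky
      · linear_combination - kx
      · linear_combination h11

lemma aux_herm (ρ : Matrix (Fin 2 × Fin 2) (Fin 2 × Fin 2) ℂ) (h : ρ.IsHermitian) :
    (ptA ρ).IsHermitian := by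
  ext p q
  simp only [conjTranspose_apply, ptA]
  exact h.apply _ _

lemma aux_eig {k : Type*} [Fintype k] [DecidableEq k] (A : Matrix k k ℂ) (h : A.IsHermitian)
    (i : k) : ∃ v : k → ℂ, star v ⬝ᵥ v = 1 ∧ star v ⬝ᵥ A *ᵥ v = (h.eigenvalues i : ℂ) := by
  have h1 : star (h.eigenvectorBasis i : k → ℂ) ⬝ᵥ (h.eigenvectorBasis i : k → ℂ) = 1 := by
    have := h.eigenvectorBasis.orthonormal.1 i
    have h2 := inner_self_eq_norm_sq_to_K (𝕜 := ℂ) (h.eigenvectorBasis i)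
    rw [this, EuclideanSpace.inner_eq_star_dotProduct, dotProduct_comm] at h2
    simpa using h2
  refine ⟨h.eigenvectorBasis i, h1, ?_⟩
  rw [h.mulVec_eigenvectorBasis, dotProduct_smul, h1]
  simp

lemma aux_conv (ψ : Fin 2 × Fin 2 → ℂ) (hu : IsUnitVec ψ) (hm : MaxEntangled ψ) :
    ∃ v : Fin 2 × Fin 2 → ℂ, v ≠ 0 ∧ ptA (proj ψ) *ᵥ v = (-(1/2) : ℂ) • v := by
  refine ⟨fun p => if p.1 = 0 then - ψ (1, p.2) else ψ (0, p.2), ?_, ?_⟩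
  · intro h0
    have h1 : ∀ p, ψ p = 0 := by
      rintro ⟨i, j⟩
      fin_cases i
      · simpa using congrFun h0 (1, j)
      · simpa using congrFun h0 (0, j)
    simp [IsUnitVec, h1] at hu
  · have e := fun i j => congrFun (congrFun hm i) j
    have e00 := e 0 0
    have e01 := e 0 1
    have e10 := e 1 0
    have e11 := e 1 1
    simp [reducedA, Fin.sum_univ_two] at e00 e01 e10 e11
    ext ⟨i, j⟩
    fin_cases i <;>
      simp [mulVec, dotProduct, ptA, proj, vecMulVec_apply, Fintype.sum_prod_type, Fin.sum_univ_two]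
    · linear_combination ψ (1, j) * e00 - ψ (0, j) * e10
    · linear_combination ψ (1, j) * e01 - ψ (0, j) * e11

theorem stmt6 (ρ : Matrix (Fin 2 × Fin 2) (Fin 2 × Fin 2) ℂ) (hρ : IsDensityMatrix ρ) :
    minEig (ptA ρ) = -(1/2) ↔
      ∃ ψ : Fin 2 × Fin 2 → ℂ, IsUnitVec ψ ∧ MaxEntangled ψ ∧ ρ = proj ψ := by
  have hH := aux_herm ρ hρ.1.1
  rw [minEig, dif_pos hH]
  constructor
  · intro h
    obtain ⟨i, hi⟩ := exists_eq_ciInf_of_finite (f := hH.eigenvalues)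
    obtain ⟨v, hv, hv2⟩ := aux_eig _ hH i
    refine (aux_quad ρ hρ v hv).2 ?_
    rw [hv2, hi, h]
    push_cast
    rfl
  · rintro ⟨ψ, hu, hm, hψ⟩
    apply le_antisymm
    · obtain ⟨v, hv0, hv⟩ := aux_conv ψ hu hm
      rw [← hψ] at hv
      have hs : (-(1/2) : ℝ) ∈ spectrum ℝ (ptA ρ) := by
        rw [← spectrum.algebraMap_mem_iff ℂ, ← Matrix.spectrum_toLin']
        apply Module.End.HasEigenvalue.mem_spectrum
        refine Module.End.hasEigenvalue_of_hasEigenvector (x := v) ⟨?_, hv0⟩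
        rw [Module.End.mem_eigenspace_iff, toLin'_apply, hv]
        simp
      rw [hH.spectrum_real_eq_range_eigenvalues] at hs
      obtain ⟨i, hi⟩ := hs
      rw [← hi]
      exact ciInf_le (Set.finite_range _).bddBelow i
    · refine le_ciInf fun i => ?_
      obtain ⟨v, hv, hv2⟩ := aux_eig _ hH i
      have := (aux_quad ρ hρ v hv).1
      rw [hv2] at this
      have h2 : ((-(1/2) : ℝ) : ℂ) ≤ (hH.eigenvalues i : ℂ) := by push_cast; exact this
      exact_mod_cast Complex.real_le_real.mp h2
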